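/- (Case k = d of Theorem 3.2.) Assume the open set condition holds and that 0 < H^D(F) < ∞, where H^D denotes D-dimensional Hausdorff measure, and let μ_F := H^D(F)^{−1} · H^D restricted to F. Then for every bounded continuous function f : ℝ^d → ℝ, lim_{ε→0+} (1/|ln ε|) ∫_ε^1 t^{D−d} (∫_{F_t} f dλ_d) dt/t = C_d^f(F) · ∫ f dμ_F, where C_d^f(F) := lim_{δ→0+} (1/|ln δ|) ∫_δ^1 t^{D−d} λ_d(F_t) dt/t is the average Minkowski content of F. That is, the measures (1/|ln ε|) ∫_ε^1 t^{D−d} λ_d(F_t ∩ ·) dt/t converge weakly to C_d^f(F) μ_F as ε → 0. -/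

import Mathlib

open Set Metric MeasureTheory Filter

lemma aux_renewal {N : ℕ} (p r : Fin N → ℝ) (hp : ∀ i, 0 ≤ p i) (hp1 : ∑ i, p i = 1)
    (ρ0 ρ1 : ℝ) (h0 : 0 < ρ0) (h1 : ρ1 < 1) (hr0 : ∀ i, ρ0 ≤ r i) (hr1 : ∀ i, r i ≤ ρ1)
    (φ : ℝ → ℝ) (τ M : ℝ) (hτ : 0 < τ)
    (hineq : ∀ t, 0 < t → t < τ → φ t ≤ ∑ i, p i * φ (t / r i))
    (hb : ∀ t, τ ≤ t → t ≤ τ / ρ0 → φ t ≤ M) :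
    ∀ t, 0 < t → t ≤ τ → φ t ≤ M := by
  have hN : Nonempty (Fin N) := by
    by_contra h
    rw [not_nonempty_iff] at h
    simp at hp1
  obtain ⟨i0⟩ := hN
  have hρ1 : 0 < ρ1 := lt_of_lt_of_le h0 ((hr0 i0).trans (hr1 i0))
  have key : ∀ n : ℕ, ∀ t, 0 < t → τ * ρ1 ^ n ≤ t → t ≤ τ / ρ0 → φ t ≤ M := by
    intro n
    induction n with
    | zero => intro t _ h h'; exact hb t (by simpa using h) h'
    | succ n ih =>
      intro t ht h h'
      rcases le_or_gt τ t with hh | hh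
      · exact hb t hh h'
      · refine (hineq t ht hh).trans ?_
        calc ∑ i, p i * φ (t / r i) ≤ ∑ i, p i * M := by
              refine Finset.sum_le_sum fun i _ => mul_le_mul_of_nonneg_left ?_ (hp i)
              have hri : 0 < r i := lt_of_lt_of_le h0 (hr0 i)
              refine ih _ (by positivity) ?_ ?_
              · rw [le_div_iff₀ hri]
                calc τ * ρ1 ^ n * r i ≤ τ * ρ1 ^ n * ρ1 := by
                      gcongr; exact hr1 i
                  _ = τ * ρ1 ^ (n + 1) := by ring
                  _ ≤ t := h
              · gcongr; exact hr0 i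
          _ = M := by rw [← Finset.sum_mul, hp1, one_mul]
  intro t ht htτ
  obtain ⟨n, hn⟩ := exists_pow_lt_of_lt_one (show 0 < t / τ by positivity) h1
  refine key n t ht ?_ ?_
  · rw [lt_div_iff₀ hτ] at hn; linarith
  · rw [le_div_iff₀ h0]
    have : ρ0 < 1 := lt_of_le_of_lt ((hr0 i0).trans (hr1 i0)) h1
    nlinarith

lemma aux_oneside {N : ℕ} (p r : Fin N → ℝ) (hp : ∀ i, 0 ≤ p i) (hp1 : ∑ i, p i = 1)
    (ρ0 ρ1 : ℝ) (h0 : 0 < ρ0) (h1 : ρ1 < 1) (hr0 : ∀ i, ρ0 ≤ r i) (hr1 : ∀ i, r i ≤ ρ1)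
    (G : ℝ → ℝ) (hG : ∀ a b, 0 < a → ∃ M, ∀ t ∈ Icc a b, G t ≤ M)
    (hlim : Tendsto (fun t => G t - ∑ i, p i * G (t / r i)) (nhdsWithin 0 (Ioi 0)) (nhds 0))
    (η : ℝ) (hη : 0 < η) :
    ∀ᶠ t in nhdsWithin 0 (Ioi 0), |Real.log t|⁻¹ * G t ≤ η := by
  have hN : Nonempty (Fin N) := by
    by_contra h
    rw [not_nonempty_iff] at h
    simp at hp1
  obtain ⟨i0⟩ := hN
  have hρ1 : 0 < ρ1 := lt_of_lt_of_le h0 ((hr0 i0).trans (hr1 i0))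
  have hl1 : 0 < -Real.log ρ1 := by have := Real.log_neg hρ1 h1; linarith
  have hev := hlim.eventually (eventually_le_nhds (show (0:ℝ) < η / 2 * (-Real.log ρ1) by positivity))
  rw [eventually_nhdsWithin_iff, Metric.eventually_nhds_iff] at hev
  obtain ⟨τ, hτ, hev⟩ := hev
  obtain ⟨M0, hM0⟩ := hG τ (τ / ρ0) hτ
  have main := aux_renewal p r hp hp1 ρ0 ρ1 h0 h1 hr0 hr1 (fun t => G t + η / 2 * Real.log t) τ
    (M0 + η / 2 * Real.log (τ / ρ0)) hτ ?_ ?_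
  · have hlog : Tendsto (fun t : ℝ => |Real.log t|) (nhdsWithin 0 (Ioi 0)) atTop :=
      tendsto_abs_atBot_atTop.comp Real.tendsto_log_nhdsGT_zero
    have e1 := hlog.eventually_ge_atTop (2 / η * (M0 + η / 2 * Real.log (τ / ρ0)))
    have e2 := hlog.eventually_gt_atTop 0
    have e3 : ∀ᶠ t in nhdsWithin (0:ℝ) (Ioi 0), t ∈ Ioo 0 (min τ 1) := Ioo_mem_nhdsGT (by positivity)
    filter_upwards [e1, e2, e3] with t e1 e2 e3
    have e4 := main t e3.1 (e3.2.le.trans (min_le_left _ _))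
    have hneg := Real.log_neg e3.1 (lt_of_lt_of_le e3.2 (min_le_right _ _))
    rw [inv_mul_le_iff₀ e2]
    rw [abs_of_neg hneg] at *
    have : η / 2 * (2 / η * (M0 + η / 2 * Real.log (τ / ρ0))) ≤ η / 2 * (- Real.log t) := by gcongr
    have h3 : η / 2 * (2 / η * (M0 + η / 2 * Real.log (τ / ρ0))) = (M0 + η / 2 * Real.log (τ / ρ0)) := by
      field_simp
    nlinarith
  · intro t ht htτ
    have e := hev (y := t) (by simpa [abs_of_pos ht] using htτ) ht
    have : ∑ i, p i * (G (t / r i) + η / 2 * Real.log (t / r i))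
        = ∑ i, p i * G (t / r i) + η / 2 * Real.log t + η / 2 * ∑ i, p i * (- Real.log (r i)) := by
      have : η / 2 * Real.log t = ∑ i, p i * (η / 2 * Real.log t) := by
        rw [← Finset.sum_mul, hp1, one_mul]
      rw [this, Finset.mul_sum, ← Finset.sum_add_distrib, ← Finset.sum_add_distrib]
      refine Finset.sum_congr rfl fun i _ => ?_
      have hri : 0 < r i := lt_of_lt_of_le h0 (hr0 i)
      rw [Real.log_div ht.ne' hri.ne']; ring
    rw [this]
    have h4 : -Real.log ρ1 ≤ ∑ i, p i * (- Real.log (r i)) := by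
      calc -Real.log ρ1 = ∑ i, p i * (-Real.log ρ1) := by rw [← Finset.sum_mul, hp1, one_mul]
        _ ≤ _ := by
          refine Finset.sum_le_sum fun i _ => mul_le_mul_of_nonneg_left ?_ (hp i)
          have hri : 0 < r i := lt_of_lt_of_le h0 (hr0 i)
          have := Real.log_le_log hri (hr1 i)
          linarith
    have : η / 2 * (-Real.log ρ1) ≤ η / 2 * ∑ i, p i * (- Real.log (r i)) := by gcongr
    linarith
  · intro t ht ht'
    have := hM0 t ⟨ht, ht'⟩
    have := Real.log_le_log (hτ.trans_le ht) ht'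
    gcongr

lemma aux_limit {N : ℕ} (p r : Fin N → ℝ) (hp : ∀ i, 0 ≤ p i) (hp1 : ∑ i, p i = 1)
    (ρ0 ρ1 : ℝ) (h0 : 0 < ρ0) (h1 : ρ1 < 1) (hr0 : ∀ i, ρ0 ≤ r i) (hr1 : ∀ i, r i ≤ ρ1)
    (H : ℝ → ℝ) (hH : ∀ s t, 0 < s → s ≤ t → H t ≤ H s) (L : ℝ)
    (hlim : Tendsto (fun t => ∑ i, p i * (H t - H (t / r i))) (nhdsWithin 0 (Ioi 0)) (nhds L)) :
    ∃ C, Tendsto (fun t => |Real.log t|⁻¹ * H t) (nhdsWithin 0 (Ioi 0)) (nhds C) := by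
  have hN : Nonempty (Fin N) := by
    by_contra h
    rw [not_nonempty_iff] at h
    simp at hp1
  obtain ⟨i0⟩ := hN
  have hρ1 : 0 < ρ1 := lt_of_lt_of_le h0 ((hr0 i0).trans (hr1 i0))
  have hl1 : 0 < -Real.log ρ1 := by have := Real.log_neg hρ1 h1; linarith
  set m := ∑ i, p i * (- Real.log (r i)) with hm
  have hmpos : 0 < m := by
    refine hl1.trans_le ?_
    calc -Real.log ρ1 = ∑ i, p i * (-Real.log ρ1) := by rw [← Finset.sum_mul, hp1, one_mul]
      _ ≤ _ := by
        refine Finset.sum_le_sum fun i _ => mul_le_mul_of_nonneg_left ?_ (hp i)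
        have hri : 0 < r i := lt_of_lt_of_le h0 (hr0 i)
        have := Real.log_le_log hri (hr1 i)
        linarith
  set a := L / m with ha
  let G : ℝ → ℝ := fun t => H t + a * Real.log t
  have hGeq : ∀ t, 0 < t → G t - ∑ i, p i * G (t / r i) = ∑ i, p i * (H t - H (t / r i)) - L := by
    intro t ht
    have h1 : G t = ∑ i, p i * G t := by rw [← Finset.sum_mul, hp1, one_mul]
    have h2 : L = ∑ i, p i * (a * (-Real.log (r i))) := by
      have : ∑ i, p i * (a * (-Real.log (r i))) = a * m := by
        rw [hm, Finset.mul_sum]; exact Finset.sum_congr rfl fun i _ => by ring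
      rw [this, ha]; field_simp
    rw [h1, h2, ← Finset.sum_sub_distrib, ← Finset.sum_sub_distrib]
    refine Finset.sum_congr rfl fun i _ => ?_
    have hri : 0 < r i := lt_of_lt_of_le h0 (hr0 i)
    simp only [G]
    rw [Real.log_div ht.ne' hri.ne']; ring
  have hGlim : Tendsto (fun t => G t - ∑ i, p i * G (t / r i)) (nhdsWithin 0 (Ioi 0)) (nhds 0) := by
    have := hlim.sub_const L
    rw [sub_self] at this
    refine this.congr' ?_
    filter_upwards [self_mem_nhdsWithin] with t ht using (hGeq t ht).symm
  have habs : ∀ x y t : ℝ, 0 < x → t ∈ Icc x y → |Real.log t| ≤ |Real.log x| + |Real.log y| := by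
    intro x y t hx ht
    have h1 := Real.log_le_log hx ht.1
    have h2 := Real.log_le_log (hx.trans_le ht.1) ht.2
    rw [abs_le]
    constructor
    · have := neg_abs_le (Real.log x); have := abs_nonneg (Real.log y); linarith
    · have := le_abs_self (Real.log y); have := abs_nonneg (Real.log x); linarith
  have up := aux_oneside p r hp hp1 ρ0 ρ1 h0 h1 hr0 hr1 G (by
    intro x y hx
    refine ⟨H x + |a| * (|Real.log x| + |Real.log y|), fun t ht => ?_⟩
    have e1 := hH x t hx ht.1
    have e2 : a * Real.log t ≤ |a| * |Real.log t| := by rw [← abs_mul]; exact le_abs_self _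
    have e3 : |a| * |Real.log t| ≤ |a| * (|Real.log x| + |Real.log y|) := by
      gcongr; exact habs x y t hx ht
    simp only [G]; linarith) hGlim
  have dn := aux_oneside p r hp hp1 ρ0 ρ1 h0 h1 hr0 hr1 (fun t => - G t) (by
    intro x y hx
    refine ⟨- H y + |a| * (|Real.log x| + |Real.log y|), fun t ht => ?_⟩
    have e1 := hH t y (hx.trans_le ht.1) ht.2
    have e2 : -(a * Real.log t) ≤ |a| * |Real.log t| := by rw [← abs_mul]; exact neg_le_abs _
    have e3 : |a| * |Real.log t| ≤ |a| * (|Real.log x| + |Real.log y|) := by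
      gcongr; exact habs x y t hx ht
    simp only [G]; linarith) (by
      have := hGlim.neg
      rw [neg_zero] at this
      refine this.congr fun t => ?_
      simp only [mul_neg, Finset.sum_neg_distrib]; ring)
  refine ⟨a, ?_⟩
  rw [Metric.tendsto_nhds]
  intro η hη
  have e3 : ∀ᶠ t in nhdsWithin (0:ℝ) (Ioi 0), t ∈ Ioo (0:ℝ) 1 := Ioo_mem_nhdsGT (by positivity)
  filter_upwards [up (η/2) (by positivity), dn (η/2) (by positivity), e3] with t u v w
  have hneg := Real.log_neg w.1 w.2
  have : |Real.log t|⁻¹ * H t - a = |Real.log t|⁻¹ * G t := by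
    simp only [G]
    rw [abs_of_neg hneg]; have := hneg.ne; field_simp; ring
  rw [Real.dist_eq, this]
  simp only [mul_neg] at v
  have : |(|Real.log t|⁻¹ * G t)| ≤ η / 2 := by rw [abs_le]; constructor <;> linarith
  linarith

lemma aux_overlap {α : Type*} [MeasurableSpace α] {N : ℕ} (m : Measure α) (A : Fin N → Set α)
    (hfin : ∀ i, m (A i) ≠ ⊤) (f : α → ℝ) (hf : Measurable f) (M : ℝ)
    (hM : ∀ x, |f x| ≤ M) :
    |∑ i, ∫ x in A i, f x ∂m - ∫ x in ⋃ i, A i, f x ∂m| ≤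
      M * (∑ i, m.real (A i) - m.real (⋃ i, A i)) := by
  have hU : m (⋃ i, A i) ≠ ⊤ := by
    refine ne_top_of_le_ne_top ?_ (measure_iUnion_fintype_le m A)
    exact ENNReal.sum_ne_top.2 fun i _ => hfin i
  have hgInt : ∀ g : α → ℝ, Measurable g → (∀ x, |g x| ≤ M) → ∀ s : Set α, m s ≠ ⊤ →
      IntegrableOn g s m := by
    intro g hg hgM s hs
    have : IsFiniteMeasure (m.restrict s) := ⟨by simpa using hs.lt_top⟩
    exact Integrable.of_bound hg.aestronglyMeasurable M (ae_of_all _ hgM)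
  have key : ∀ g : α → ℝ, Measurable g → (∀ x, |g x| ≤ M) →
      ∫ x in ⋃ i, A i, g x ∂m - ∑ i, ∫ x in A i, g x ∂m ≤
        M * (∑ i, m.real (A i) - m.real (⋃ i, A i)) := by
    intro g hg hgM
    have hc : ∀ s : Set α, m s ≠ ⊤ → IntegrableOn (fun _ => M) s m := fun s hs =>
      integrableOn_const hs
    have hadd : ∀ s : Set α, m s ≠ ⊤ →
        ∫ x in s, (M + g x) ∂m = M * m.real s + ∫ x in s, g x ∂m := by
      intro s hs
      rw [integral_add (hc s hs) (hgInt g hg hgM s hs)]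
      simp [mul_comm]
    have hle : ∫ x in ⋃ i, A i, (M + g x) ∂m ≤ ∑ i, ∫ x in A i, (M + g x) ∂m := by
      have hs := integral_finsetSum_measure (s := Finset.univ) (f := fun x => M + g x)
        (μ := fun i => m.restrict (A i))
        (fun i _ => (hc _ (hfin i)).add (hgInt g hg hgM _ (hfin i)))
      rw [← hs]
      refine integral_mono_measure ?_ (ae_of_all _ fun x => ?_) ?_
      · have := Measure.restrict_iUnion_le (μ := m) (s := A)
        rwa [Measure.sum_fintype] at this
      · have := neg_abs_le (g x); have := hgM x
        simp only [Pi.zero_apply]; linarith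
      · exact integrable_finsetSum_measure.2
          (fun i _ => (hc _ (hfin i)).add (hgInt g hg hgM _ (hfin i)))
    rw [hadd _ hU, Finset.sum_congr rfl fun i _ => hadd _ (hfin i), Finset.sum_add_distrib,
      ← Finset.mul_sum] at hle
    linarith
  have k1 := key f hf hM
  have k2 := key (fun x => - f x) hf.neg (by simpa using hM)
  simp only [integral_neg, Finset.sum_neg_distrib] at k2
  rw [abs_le]; constructor <;> linarith

lemma aux_image {α : Type*} [MeasurableSpace α] (m : Measure α) (S : α → α)
    (hS : MeasurableEmbedding S) (hs : Function.Surjective S) (c : ℝ) (hc : 0 < c)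
    (hm : ∀ A, m (S '' A) = ENNReal.ofReal c * m A) (A : Set α) (f : α → ℝ) :
    ∫ x in S '' A, f x ∂m = c * ∫ x in A, f (S x) ∂m := by
  have h : m = ENNReal.ofReal c • Measure.map S m := by
    ext B hB
    rw [Measure.smul_apply, hS.map_apply, smul_eq_mul, ← hm, image_preimage_eq _ hs]
  conv_lhs => rw [h]
  rw [Measure.restrict_smul, integral_smul_measure, hS.setIntegral_map,
    preimage_image_eq _ hS.injective, ENNReal.toReal_ofReal hc.le, smul_eq_mul]

section geom
variable {d : ℕ}

local notation "EE" => EuclideanSpace ℝ (Fin d)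

lemma aux_hausdorff (S : EE → EE) (r : ℝ) (hr : 0 < r)
    (hS : ∀ x y, dist (S x) (S y) = r * dist x y) (D : ℝ) (hD : 0 ≤ D) (A : Set EE) :
    Measure.hausdorffMeasure (d := D) (S '' A) =
      ENNReal.ofReal (r ^ D) * Measure.hausdorffMeasure (d := D) A := by
  have hl : LipschitzWith r.toNNReal S := LipschitzWith.of_dist_le_mul fun x y => by
    rw [hS, Real.coe_toNNReal _ hr.le]
  have ha : AntilipschitzWith (r⁻¹).toNNReal S := AntilipschitzWith.of_le_mul_dist fun x y => by
    rw [hS, Real.coe_toNNReal _ (by positivity)]; field_simp; rfl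
  have h1 := hl.hausdorffMeasure_image_le hD A
  have h2 := ha.le_hausdorffMeasure_image hD A
  have e1 : ((r.toNNReal : NNReal) : ENNReal) ^ D = ENNReal.ofReal (r ^ D) := by
    rw [← ENNReal.ofReal_rpow_of_pos hr]; rfl
  have e2 : (((r⁻¹).toNNReal : NNReal) : ENNReal) ^ D = (ENNReal.ofReal (r ^ D))⁻¹ := by
    rw [← ENNReal.ofReal_rpow_of_pos hr, ← ENNReal.inv_rpow, ← ENNReal.ofReal_inv_of_pos hr]; rfl
  rw [e1] at h1
  rw [e2] at h2
  refine le_antisymm h1 ?_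
  have hp : 0 < r ^ D := Real.rpow_pos_of_pos hr D
  have h0 : ENNReal.ofReal (r ^ D) ≠ 0 := by simpa using hp
  calc _ ≤ ENNReal.ofReal (r ^ D) * ((ENNReal.ofReal (r ^ D))⁻¹ *
        Measure.hausdorffMeasure (d := D) (S '' A)) := by gcongr
    _ = _ := by rw [← mul_assoc, ENNReal.mul_inv_cancel h0 ENNReal.ofReal_ne_top, one_mul]

lemma aux_volume (S : EE → EE) (r : ℝ) (hr : 0 < r)
    (hS : ∀ x y, dist (S x) (S y) = r * dist x y) (A : Set EE) :
    volume (S '' A) = ENNReal.ofReal (r ^ d) * volume A := by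
  have h := Measure.isAddLeftInvariant_eq_smul (volume : Measure EE)
    (Measure.hausdorffMeasure (d := (d : ℝ)))
  have h2 := aux_hausdorff S r hr hS (d : ℝ) (by positivity) A
  rw [Real.rpow_natCast] at h2
  rw [h, Measure.smul_apply, Measure.smul_apply, h2, ENNReal.smul_def, ENNReal.smul_def,
    smul_eq_mul, smul_eq_mul]
  ring

lemma aux_emb (S : EE → EE) (r : ℝ) (hr : 0 < r)
    (hS : ∀ x y, dist (S x) (S y) = r * dist x y) : 
    Continuous S ∧ MeasurableEmbedding S := by
  have hl : LipschitzWith r.toNNReal S := LipschitzWith.of_dist_le_mul fun x y => by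
    rw [hS, Real.coe_toNNReal _ hr.le]
  have ha : AntilipschitzWith (r⁻¹).toNNReal S := AntilipschitzWith.of_le_mul_dist fun x y => by
    rw [hS, Real.coe_toNNReal _ (by positivity)]; field_simp; rfl
  exact ⟨hl.continuous, (ha.isClosedEmbedding hl.uniformContinuous).measurableEmbedding⟩

lemma aux_thick (S : EE → EE) (r : ℝ) (hr : 0 < r) (hs : Function.Surjective S)
    (hS : ∀ x y, dist (S x) (S y) = r * dist x y) (F : Set EE) (hF : IsCompact F)
    (t : ℝ) (ht : 0 ≤ t) :
    cthickening t (S '' F) = S '' cthickening (t / r) F := by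
  have hc := (aux_emb S r hr hS).1
  rw [hF.cthickening_eq_biUnion_closedBall (by positivity),
    (hF.image hc).cthickening_eq_biUnion_closedBall ht]
  ext y
  obtain ⟨x, rfl⟩ := hs y
  simp only [mem_iUnion, mem_image, mem_closedBall, exists_prop]
  constructor
  · rintro ⟨_, ⟨z, hz, rfl⟩, hd⟩
    refine ⟨x, ⟨z, hz, ?_⟩, rfl⟩
    rw [hS] at hd
    rw [le_div_iff₀ hr]; linarith
  · rintro ⟨x', ⟨z, hz, hd⟩, he⟩
    refine ⟨S z, ⟨z, hz, rfl⟩, ?_⟩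
    rw [← he, hS]
    rw [le_div_iff₀ hr] at hd; linarith

lemma aux_thickU {N : ℕ} (A : Fin N → Set EE) (hA : ∀ i, IsCompact (A i)) (t : ℝ) (ht : 0 ≤ t) :
    cthickening t (⋃ i, A i) = ⋃ i, cthickening t (A i) := by
  rw [(isCompact_iUnion hA).cthickening_eq_biUnion_closedBall ht]
  simp_rw [fun i => (hA i).cthickening_eq_biUnion_closedBall ht]
  ext x; simp only [mem_iUnion, exists_prop]
  constructor
  · rintro ⟨y, ⟨i, hi⟩, h⟩; exact ⟨i, y, hi, h⟩
  · rintro ⟨i, y, hi, h⟩; exact ⟨y, ⟨i, hi⟩, h⟩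

/-- integral over parallel set -/
noncomputable def auxP (K : Set EE) (f : EE → ℝ) (t : ℝ) : ℝ := ∫ x in cthickening t K, f x

lemma aux_fin (K : Set EE) (hK : IsCompact K) (t : ℝ) : volume (cthickening t K) ≠ ⊤ :=
  hK.cthickening.measure_ne_top

lemma aux_int (K : Set EE) (hK : IsCompact K) (t : ℝ) (f : EE → ℝ) (hf : Continuous f) :
    IntegrableOn f (cthickening t K) volume := hf.continuousOn.integrableOn_compact hK.cthickening

lemma auxP_mono (K : Set EE) (hK : IsCompact K) (f : EE → ℝ) (hf : Continuous f)
    (h0 : ∀ x, 0 ≤ f x) : Monotone (auxP K f) := by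
  intro s t hst
  exact setIntegral_mono_set (aux_int K hK t f hf) (ae_of_all _ h0)
    (cthickening_mono hst K).eventuallyLE

/-- rescaled integrand -/
noncomputable def auxh (D : ℝ) (K : Set EE) (f : EE → ℝ) (t : ℝ) : ℝ :=
  t ^ (D - d) * auxP K f t * t⁻¹

lemma auxP_add (K : Set EE) (hK : IsCompact K) (f g : EE → ℝ) (hf : Continuous f)
    (hg : Continuous g) (t : ℝ) :
    auxP K (fun x => f x + g x) t = auxP K f t + auxP K g t :=
  integral_add (aux_int K hK t f hf) (aux_int K hK t g hg)

lemma auxh_int (D : ℝ) (K : Set EE) (hK : IsCompact K) (f : EE → ℝ) (hf : Continuous f)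
    (M : ℝ) (hM : ∀ x, |f x| ≤ M) (a b : ℝ) (ha : 0 < a) (hb : 0 < b) :
    IntervalIntegrable (auxh D K f) volume a b := by
  have h1 : IntervalIntegrable (auxP K f) volume a b := by
    have hM0 : 0 ≤ M := (abs_nonneg _).trans (hM 0)
    have e : auxP K f = fun t => auxP K (fun x => f x + M) t - auxP K (fun _ => M) t := by
      funext t
      rw [auxP_add K hK f (fun _ => M) hf continuous_const]; ring
    rw [e]
    refine ((auxP_mono K hK _ (by fun_prop) ?_).intervalIntegrable).sub
      ((auxP_mono K hK _ (by fun_prop) ?_).intervalIntegrable)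
    · intro x; have := neg_abs_le (f x); have := hM x; linarith
    · intro x; exact hM0
  have hpos : ∀ t ∈ uIcc a b, t ≠ 0 := by
    intro t ht
    have : 0 < min a b := lt_min ha hb
    exact (this.trans_le ht.1).ne'
  have hc1 : ContinuousOn (fun t : ℝ => t ^ (D - d)) (uIcc a b) := fun t ht =>
    (Real.continuousAt_rpow_const t _ (Or.inl (hpos t ht))).continuousWithinAt
  have hc2 : ContinuousOn (fun t : ℝ => t⁻¹) (uIcc a b) := continuousOn_inv₀.mono hpos
  exact (h1.continuousOn_mul hc1).mul_continuousOn hc2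

lemma auxP_bound (K : Set EE) (hK : IsCompact K) (f : EE → ℝ) (hf : Continuous f) (t η : ℝ)
    (c : ℝ) (hη : ∀ x ∈ cthickening t K, |f x - c| ≤ η) :
    |auxP K f t - c * auxP K (fun _ => 1) t| ≤ η * auxP K (fun _ => 1) t := by
  have e : auxP K f t - c * auxP K (fun _ => 1) t = ∫ x in cthickening t K, (f x - c) := by
    unfold auxP
    rw [integral_sub (aux_int K hK t f hf) (aux_int K hK t _ continuous_const)]
    simp [mul_comm]
  rw [e]
  have := norm_setIntegral_le_of_norm_le_const (μ := volume) (f := fun x => f x - c)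
    (aux_fin K hK t).lt_top (C := η) hη
  rw [Real.norm_eq_abs] at this
  simpa [auxP] using this

lemma auxh_bound (D : ℝ) (K : Set EE) (hK : IsCompact K) (f : EE → ℝ) (hf : Continuous f)
    (t η : ℝ) (ht : 0 < t) (c : ℝ) (hη : ∀ x ∈ cthickening t K, |f x - c| ≤ η) :
    |auxh D K f t - c * auxh D K (fun _ => 1) t| ≤ η * auxh D K (fun _ => 1) t := by
  have h := auxP_bound K hK f hf t η c hη
  have h1 : 0 ≤ t ^ (D - d) * t⁻¹ := by positivity
  have e : auxh D K f t - c * auxh D K (fun _ => 1) t =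
    (t ^ (D - d) * t⁻¹) * (auxP K f t - c * auxP K (fun _ => 1) t) := by unfold auxh; ring
  rw [e, abs_mul, abs_of_nonneg h1]
  calc _ ≤ (t ^ (D - d) * t⁻¹) * (η * auxP K (fun _ => 1) t) := by gcongr
    _ = _ := by unfold auxh; ring

lemma auxh_nonneg (D : ℝ) (K : Set EE) (t : ℝ) (ht : 0 < t) : 0 ≤ auxh D K (fun _ => 1) t := by
  have : 0 ≤ auxP K (fun _ => 1) t := integral_nonneg fun _ => zero_le_one
  unfold auxh; positivity

lemma auxP_scale (S : EE → EE) (r : ℝ) (hr : 0 < r) (hs : Function.Surjective S)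
    (hS : ∀ x y, dist (S x) (S y) = r * dist x y) (F : Set EE) (hF : IsCompact F)
    (f : EE → ℝ) (t : ℝ) (ht : 0 ≤ t) :
    auxP (S '' F) f t = r ^ d * auxP F (fun x => f (S x)) (t / r) := by
  unfold auxP
  rw [aux_thick S r hr hs hS F hF t ht]
  exact aux_image volume S (aux_emb S r hr hS).2 hs (r ^ d) (by positivity)
    (aux_volume S r hr hS) _ f

lemma auxh_scale (D : ℝ) (S : EE → EE) (r : ℝ) (hr : 0 < r) (hs : Function.Surjective S)
    (hS : ∀ x y, dist (S x) (S y) = r * dist x y) (F : Set EE) (hF : IsCompact F)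
    (f : EE → ℝ) (t : ℝ) (ht : 0 < t) :
    auxh D (S '' F) f t = r ^ D * (r⁻¹ * auxh D F (fun x => f (S x)) (t / r)) := by
  unfold auxh
  rw [auxP_scale S r hr hs hS F hF f t ht.le, Real.div_rpow ht.le hr.le, Real.rpow_sub hr,
    Real.rpow_natCast]
  have : 0 < r ^ D := Real.rpow_pos_of_pos hr D
  field_simp

lemma auxh_scale_int (D : ℝ) (S : EE → EE) (r : ℝ) (hr : 0 < r) (hs : Function.Surjective S)
    (hS : ∀ x y, dist (S x) (S y) = r * dist x y) (F : Set EE) (hF : IsCompact F)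
    (f : EE → ℝ) (ε : ℝ) (hε : 0 < ε) :
    ∫ t in ε..1, auxh D (S '' F) f t =
      r ^ D * ∫ t in (ε / r)..(1 / r), auxh D F (fun x => f (S x)) t := by
  have : ∫ t in ε..1, auxh D (S '' F) f t =
      ∫ t in ε..1, r ^ D * (r⁻¹ * auxh D F (fun x => f (S x)) (t / r)) := by
    refine intervalIntegral.integral_congr fun t ht => ?_
    have : 0 < min ε 1 := lt_min hε one_pos
    exact auxh_scale D S r hr hs hS F hF f t (this.trans_le ht.1)
  rw [this, intervalIntegral.integral_const_mul, intervalIntegral.integral_const_mul,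
    ← intervalIntegral.inv_smul_integral_comp_div, smul_eq_mul]

/-- overlap integrand -/
noncomputable def auxz {N : ℕ} (D : ℝ) (S : Fin N → EE → EE) (F : Set EE) (f : EE → ℝ) (t : ℝ) :
    ℝ := ∑ i, auxh D (S i '' F) f t - auxh D F f t

lemma auxz_bound {N : ℕ} (D : ℝ) (S : Fin N → EE → EE) (hS : ∀ i, Continuous (S i)) (F : Set EE)
    (hK : IsCompact F) (hF : F = ⋃ i, S i '' F)
    (f : EE → ℝ) (hf : Continuous f) (M : ℝ) (hM : ∀ x, |f x| ≤ M) (t : ℝ) (ht : 0 < t) :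
    |auxz D S F f t| ≤ M * auxz D S F (fun _ => 1) t := by
  have hU : cthickening t F = ⋃ i, cthickening t (S i '' F) := by
    conv_lhs => rw [hF]
    exact aux_thickU _ (fun i => hK.image (hS i)) t ht.le
  have h := aux_overlap volume (fun i => cthickening t (S i '' F))
    (fun i => aux_fin _ (hK.image (hS i)) t) f hf.measurable M hM
  rw [← hU] at h
  have h1 : 0 ≤ t ^ (D - d) * t⁻¹ := by positivity
  have e : ∀ g, auxz D S F g t =
    (t ^ (D - d) * t⁻¹) * (∑ i, auxP (S i '' F) g t - auxP F g t) := by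
    intro g
    unfold auxz auxh; rw [mul_sub, Finset.mul_sum]
    congr 1
    · exact Finset.sum_congr rfl fun i _ => by ring
    · ring
  rw [e, e, abs_mul, abs_of_nonneg h1]
  calc _ ≤ (t ^ (D - d) * t⁻¹) * (M * (∑ i, auxP (S i '' F) (fun _ => 1) t
        - auxP F (fun _ => 1) t)) := by
        gcongr
        simpa [auxP] using h
    _ = _ := by ring

end geom

section main
variable {d N : ℕ}

local notation "EE" => EuclideanSpace ℝ (Fin d)

lemma aux_ident (D : ℝ) (r : Fin N → ℝ) (hr : ∀ i, r i ∈ Set.Ioo (0 : ℝ) 1)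
    (S : Fin N → EE → EE) (hSsurj : ∀ i, Function.Surjective (S i))
    (hSdist : ∀ i x y, dist (S i x) (S i y) = r i * dist x y)
    (F : Set EE) (hFcpt : IsCompact F)
    (f : EE → ℝ) (hf : Continuous f) (M : ℝ) (hM : ∀ x, |f x| ≤ M) (ε : ℝ) (hε : 0 < ε) :
    ∫ t in ε..1, auxh D F f t =
      ∑ i, r i ^ D * ((∫ t in (ε / r i)..1, auxh D F (fun x => f (S i x)) t)
        - ∫ t in (1 / r i)..1, auxh D F (fun x => f (S i x)) t)
      - ∫ t in ε..1, auxz D S F f t := by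
  have hc : ∀ i, Continuous (S i) := fun i => (aux_emb (S i) (r i) (hr i).1 (hSdist i)).1
  have hi : ∀ i, IntervalIntegrable (auxh D (S i '' F) f) volume ε 1 := fun i =>
    auxh_int D _ (hFcpt.image (hc i)) f hf M hM ε 1 hε one_pos
  unfold auxz
  rw [intervalIntegral.integral_sub, intervalIntegral.integral_finsetSum (fun i _ => hi i)]
  · have : ∀ i, r i ^ D * ((∫ t in (ε / r i)..1, auxh D F (fun x => f (S i x)) t)
        - ∫ t in (1 / r i)..1, auxh D F (fun x => f (S i x)) t) =
        ∫ t in ε..1, auxh D (S i '' F) f t := by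
      intro i
      have hri := (hr i).1
      rw [auxh_scale_int D (S i) (r i) hri (hSsurj i) (hSdist i) F hFcpt f ε hε]
      have hg : ∀ a b : ℝ, 0 < a → 0 < b →
          IntervalIntegrable (auxh D F (fun x => f (S i x))) volume a b := fun a b ha hb =>
        auxh_int D F hFcpt _ (hf.comp (hc i)) M (fun x => hM _) a b ha hb
      rw [← intervalIntegral.integral_add_adjacent_intervals
        (hg (ε / r i) (1 / r i) (by positivity) (by positivity)) (hg (1 / r i) 1 (by positivity) one_pos)]
      ring
    rw [Finset.sum_congr rfl fun i _ => this i]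
    ring
  · have := IntervalIntegrable.sum Finset.univ (fun i _ => hi i)
    have e : (fun t => ∑ i, auxh D (S i '' F) f t) = ∑ i, auxh D (S i '' F) f := by
      ext t; simp
    rw [e]; exact this
  · exact auxh_int D F hFcpt f hf M hM ε 1 hε one_pos

lemma aux_H_anti (D : ℝ) (F : Set EE) (hFcpt : IsCompact F) (s t : ℝ) (hs : 0 < s) (hst : s ≤ t) :
    ∫ u in t..1, auxh D F (fun _ => 1) u ≤ ∫ u in s..1, auxh D F (fun _ => 1) u := by
  have hg : ∀ a b : ℝ, 0 < a → 0 < b →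
      IntervalIntegrable (auxh D F (fun _ => 1)) volume a b := fun a b ha hb =>
    auxh_int D F hFcpt _ continuous_const 1 (fun x => by simp) a b ha hb
  rw [← intervalIntegral.integral_add_adjacent_intervals
    (hg s t hs (hs.trans_le hst)) (hg t 1 (hs.trans_le hst) one_pos)]
  have : 0 ≤ ∫ u in s..t, auxh D F (fun _ => 1) u :=
    intervalIntegral.integral_nonneg hst fun u hu => auxh_nonneg D F u (hs.trans_le hu.1)
  linarith

lemma aux_H_diff (D : ℝ) (F : Set EE) (hFcpt : IsCompact F) (f : EE → ℝ) (hf : Continuous f)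
    (M : ℝ) (hM : ∀ x, |f x| ≤ M) (s t : ℝ) (hs : 0 < s) (hst : s ≤ t) :
    |(∫ u in s..1, auxh D F f u) - ∫ u in t..1, auxh D F f u| ≤
      M * ((∫ u in s..1, auxh D F (fun _ => 1) u) - ∫ u in t..1, auxh D F (fun _ => 1) u) := by
  have ht := hs.trans_le hst
  have hg : ∀ a b : ℝ, 0 < a → 0 < b →
      IntervalIntegrable (auxh D F (fun _ => 1)) volume a b := fun a b ha hb =>
    auxh_int D F hFcpt _ continuous_const 1 (fun x => by simp) a b ha hb
  have hg' : ∀ a b : ℝ, 0 < a → 0 < b →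
      IntervalIntegrable (auxh D F f) volume a b := fun a b ha hb =>
    auxh_int D F hFcpt f hf M hM a b ha hb
  rw [← intervalIntegral.integral_add_adjacent_intervals (hg s t hs ht) (hg t 1 ht one_pos),
    ← intervalIntegral.integral_add_adjacent_intervals (hg' s t hs ht) (hg' t 1 ht one_pos)]
  rw [add_sub_cancel_right, add_sub_cancel_right, ← intervalIntegral.integral_const_mul]
  rw [← Real.norm_eq_abs]
  refine intervalIntegral.norm_integral_le_of_norm_le hst (ae_of_all _ fun u hu => ?_)
    ((hg s t hs ht).const_mul M)
  have := auxh_bound D F hFcpt f hf u M (hs.trans hu.1) 0 (by simpa using fun x _ => hM x)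
  simpa using this

/-- averaging operator -/
noncomputable def auxT (p : Fin N → ℝ) (S : Fin N → EE → EE) (f : EE → ℝ) (x : EE) : ℝ :=
  ∑ i, p i * f (S i x)

lemma auxT_bound (p : Fin N → ℝ) (hp : ∀ i, 0 ≤ p i) (hp1 : ∑ i, p i = 1)
    (S : Fin N → EE → EE) (f : EE → ℝ) (M : ℝ) (hM : ∀ x, |f x| ≤ M) (x : EE) :
    |auxT p S f x| ≤ M := by
  unfold auxT
  refine (Finset.abs_sum_le_sum_abs _ _).trans ?_
  calc _ ≤ ∑ i, p i * M := by
        refine Finset.sum_le_sum fun i _ => ?_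
        rw [abs_mul, abs_of_nonneg (hp i)]
        exact mul_le_mul_of_nonneg_left (hM _) (hp i)
    _ = M := by rw [← Finset.sum_mul, hp1, one_mul]

lemma auxh_T (D : ℝ) (p : Fin N → ℝ) (S : Fin N → EE → EE) (hc : ∀ i, Continuous (S i))
    (F : Set EE) (hFcpt : IsCompact F) (f : EE → ℝ) (hf : Continuous f) (t : ℝ) :
    auxh D F (auxT p S f) t = ∑ i, p i * auxh D F (fun x => f (S i x)) t := by
  unfold auxh auxP auxT
  rw [integral_finsetSum Finset.univ (f := fun i x => p i * f (S i x))
    fun i _ => (aux_int F hFcpt t _ (hf.comp (hc i))).const_mul (p i)]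
  simp_rw [integral_const_mul]
  rw [Finset.mul_sum, Finset.sum_mul]
  exact Finset.sum_congr rfl fun i _ => by ring

lemma aux_step (D : ℝ) (r : Fin N → ℝ) (hr : ∀ i, r i ∈ Set.Ioo (0 : ℝ) 1)
    (hDsum : ∑ i, r i ^ D = 1)
    (S : Fin N → EE → EE) (hSsurj : ∀ i, Function.Surjective (S i))
    (hSdist : ∀ i x y, dist (S i x) (S i y) = r i * dist x y)
    (F : Set EE) (hFcpt : IsCompact F) (hF : F = ⋃ i, S i '' F) :
    ∃ C : ℝ, ∀ f : EE → ℝ, Continuous f → ∀ M : ℝ, (∀ x, |f x| ≤ M) → ∀ ε ∈ Ioc (0:ℝ) 1,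
      |(∫ t in ε..1, auxh D F f t) - ∫ t in ε..1, auxh D F (auxT (fun i => r i ^ D) S f) t|
        ≤ C * M := by
  set H : ℝ → ℝ := fun ε => ∫ t in ε..1, auxh D F (fun _ => 1) t with hH
  set c := ∑ i, r i ^ D * (- H (1 / r i)) with hcdef
  have hp : ∀ i, 0 ≤ r i ^ D := fun i => Real.rpow_nonneg (hr i).1.le D
  have hc : ∀ i, Continuous (S i) := fun i => (aux_emb (S i) (r i) (hr i).1 (hSdist i)).1
  have hdiv : ∀ i, ∀ ε : ℝ, 0 < ε → ε ≤ ε / r i := fun i ε hε => by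
    rw [le_div_iff₀ (hr i).1]; nlinarith [(hr i).2]
  have hzint : ∀ f : EE → ℝ, Continuous f → ∀ M, (∀ x, |f x| ≤ M) → ∀ a b : ℝ, 0 < a → 0 < b →
      IntervalIntegrable (auxz D S F f) volume a b := by
    intro f hf M hM a b ha hb
    have h1 := IntervalIntegrable.sum Finset.univ (fun i (_ : i ∈ Finset.univ) =>
      auxh_int D _ (hFcpt.image (hc i)) f hf M hM a b ha hb)
    have := h1.sub (auxh_int D F hFcpt f hf M hM a b ha hb)
    convert this using 1
    ext t; simp [auxz]
  have key : ∀ ε, 0 < ε → ∑ i, r i ^ D * (H ε - H (ε / r i)) + ∫ t in ε..1, auxz D S F (fun _ => 1) t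
      = c := by
    intro ε hε
    have := aux_ident D r hr S hSsurj hSdist F hFcpt (fun _ => 1) continuous_const 1 (by simp) ε hε
    have e : H ε = ∑ i, r i ^ D * (H (ε / r i) - H (1 / r i)) -
      ∫ t in ε..1, auxz D S F (fun _ => 1) t := this
    have e2 : H ε = ∑ i, r i ^ D * H ε := by rw [← Finset.sum_mul, hDsum, one_mul]
    simp only [mul_sub, Finset.sum_sub_distrib, mul_neg, Finset.sum_neg_distrib, hcdef] at e ⊢
    linarith
  have hz0 : ∀ ε ∈ Ioc (0:ℝ) 1, 0 ≤ ∫ t in ε..1, auxz D S F (fun _ => 1) t := by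
    intro ε hε
    refine intervalIntegral.integral_nonneg hε.2 fun u hu => ?_
    have := auxz_bound D S hc F hFcpt hF (fun _ => 1) continuous_const 1 (by simp) u
      (hε.1.trans_le hu.1)
    have := (abs_nonneg _).trans this
    linarith
  have hJ0 : ∀ ε, 0 < ε → 0 ≤ ∑ i, r i ^ D * (H ε - H (ε / r i)) := by
    intro ε hε
    refine Finset.sum_nonneg fun i _ => mul_nonneg (hp i) ?_
    have := aux_H_anti D F hFcpt ε (ε / r i) hε (hdiv i ε hε)
    simp only [hH]; linarith
  refine ⟨3 * c, fun f hf M hM ε hε => ?_⟩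
  have hM0 : 0 ≤ M := (abs_nonneg _).trans (hM 0)
  have hfi : ∀ i, Continuous (fun x => f (S i x)) := fun i => hf.comp (hc i)
  have hT : ∫ t in ε..1, auxh D F (auxT (fun i => r i ^ D) S f) t =
      ∑ i, r i ^ D * ∫ t in ε..1, auxh D F (fun x => f (S i x)) t := by
    simp_rw [auxh_T D _ S hc F hFcpt f hf]
    rw [intervalIntegral.integral_finsetSum]
    · simp_rw [intervalIntegral.integral_const_mul]
    · intro i _
      exact (auxh_int D F hFcpt _ (hfi i) M (fun x => hM _) ε 1 hε.1 one_pos).const_mul _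
  have hid := aux_ident D r hr S hSsurj hSdist F hFcpt f hf M hM ε hε.1
  have b1 : |∑ i, r i ^ D * ((∫ t in ε..1, auxh D F (fun x => f (S i x)) t) -
      ∫ t in (ε / r i)..1, auxh D F (fun x => f (S i x)) t)| ≤
      M * ∑ i, r i ^ D * (H ε - H (ε / r i)) := by
    refine (Finset.abs_sum_le_sum_abs _ _).trans ?_
    rw [Finset.mul_sum]
    refine Finset.sum_le_sum fun i _ => ?_
    rw [abs_mul, abs_of_nonneg (hp i), mul_left_comm]
    exact mul_le_mul_of_nonneg_left (aux_H_diff D F hFcpt _ (hfi i) M (fun x => hM _) ε (ε / r i)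
      hε.1 (hdiv i ε hε.1)) (hp i)
  have b2 : |∑ i, r i ^ D * (∫ t in (1 / r i)..1, auxh D F (fun x => f (S i x)) t)| ≤ M * c := by
    refine (Finset.abs_sum_le_sum_abs _ _).trans ?_
    rw [hcdef, Finset.mul_sum]
    refine Finset.sum_le_sum fun i _ => ?_
    rw [abs_mul, abs_of_nonneg (hp i), mul_left_comm]
    have := aux_H_diff D F hFcpt _ (hfi i) M (fun x => hM _) 1 (1 / r i) one_pos (hdiv i 1 one_pos)
    simp only [intervalIntegral.integral_same, zero_sub, abs_neg] at this
    exact mul_le_mul_of_nonneg_left this (hp i)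
  have b3 : |∫ t in ε..1, auxz D S F f t| ≤ M * ∫ t in ε..1, auxz D S F (fun _ => 1) t := by
    rw [← intervalIntegral.integral_const_mul, ← Real.norm_eq_abs]
    exact intervalIntegral.norm_integral_le_of_norm_le hε.2 (ae_of_all _ fun u hu =>
      auxz_bound D S hc F hFcpt hF f hf M hM u (hε.1.trans hu.1))
      ((hzint (fun _ => 1) continuous_const 1 (by simp) ε 1 hε.1 one_pos).const_mul M)
  have k := key ε hε.1
  have b1' : M * ∑ i, r i ^ D * (H ε - H (ε / r i)) ≤ M * c :=
    mul_le_mul_of_nonneg_left (by linarith [hz0 ε hε]) hM0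
  have b3' : M * ∫ t in ε..1, auxz D S F (fun _ => 1) t ≤ M * c :=
    mul_le_mul_of_nonneg_left (by linarith [hJ0 ε hε.1]) hM0
  rw [hT, hid]
  replace b1 := b1.trans b1'
  clear b1'
  simp only [mul_sub, Finset.sum_sub_distrib] at b1 ⊢
  rw [abs_le] at *
  constructor <;> linarith [b1.1, b1.2, b2.1, b2.2, b3.1, b3.2]

lemma aux_content (D : ℝ) (r : Fin N → ℝ) (hr : ∀ i, r i ∈ Set.Ioo (0 : ℝ) 1)
    (hDsum : ∑ i, r i ^ D = 1)
    (S : Fin N → EE → EE) (hSsurj : ∀ i, Function.Surjective (S i))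
    (hSdist : ∀ i x y, dist (S i x) (S i y) = r i * dist x y)
    (F : Set EE) (hFcpt : IsCompact F) (hF : F = ⋃ i, S i '' F)
    (ρ0 ρ1 : ℝ) (h0 : 0 < ρ0) (h1 : ρ1 < 1) (hr0 : ∀ i, ρ0 ≤ r i) (hr1 : ∀ i, r i ≤ ρ1) :
    ∃ C, Tendsto (fun ε => |Real.log ε|⁻¹ * ∫ t in ε..1, auxh D F (fun _ => 1) t)
      (nhdsWithin 0 (Ioi 0)) (nhds C) := by
  set H : ℝ → ℝ := fun ε => ∫ t in ε..1, auxh D F (fun _ => 1) t with hH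
  set c := ∑ i, r i ^ D * (- H (1 / r i)) with hcdef
  have hp : ∀ i, 0 ≤ r i ^ D := fun i => Real.rpow_nonneg (hr i).1.le D
  have hc : ∀ i, Continuous (S i) := fun i => (aux_emb (S i) (r i) (hr i).1 (hSdist i)).1
  have hdiv : ∀ i, ∀ ε : ℝ, 0 < ε → ε ≤ ε / r i := fun i ε hε => by
    rw [le_div_iff₀ (hr i).1]; nlinarith [(hr i).2]
  have hzint : ∀ a b : ℝ, 0 < a → 0 < b →
      IntervalIntegrable (auxz D S F (fun _ => 1)) volume a b := by
    intro a b ha hb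
    have h1 := IntervalIntegrable.sum Finset.univ (fun i (_ : i ∈ Finset.univ) =>
      auxh_int D _ (hFcpt.image (hc i)) (fun _ => 1) continuous_const 1 (by simp) a b ha hb)
    have := h1.sub (auxh_int D F hFcpt (fun _ => 1) continuous_const 1 (by simp) a b ha hb)
    convert this using 1
    ext t; simp [auxz]
  have key : ∀ ε, 0 < ε → ∑ i, r i ^ D * (H ε - H (ε / r i))
      = c - ∫ t in ε..1, auxz D S F (fun _ => 1) t := by
    intro ε hε
    have := aux_ident D r hr S hSsurj hSdist F hFcpt (fun _ => 1) continuous_const 1 (by simp) ε hε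
    have e : H ε = ∑ i, r i ^ D * (H (ε / r i) - H (1 / r i)) -
      ∫ t in ε..1, auxz D S F (fun _ => 1) t := this
    have e2 : H ε = ∑ i, r i ^ D * H ε := by rw [← Finset.sum_mul, hDsum, one_mul]
    simp only [mul_sub, Finset.sum_sub_distrib, mul_neg, Finset.sum_neg_distrib, hcdef] at e ⊢
    linarith
  have hJ0 : ∀ ε, 0 < ε → 0 ≤ ∑ i, r i ^ D * (H ε - H (ε / r i)) := by
    intro ε hε
    refine Finset.sum_nonneg fun i _ => mul_nonneg (hp i) ?_
    have := aux_H_anti D F hFcpt ε (ε / r i) hε (hdiv i ε hε)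
    simp only [hH]; linarith
  have hmono : MonotoneOn (fun ε => c - ∫ t in ε..1, auxz D S F (fun _ => 1) t) (Ioi (0:ℝ)) := by
    intro s hs t ht hst
    have hs' : 0 < s := hs
    have ht' : 0 < t := ht
    simp only
    rw [← intervalIntegral.integral_add_adjacent_intervals
      (hzint s t hs' ht') (hzint t 1 ht' one_pos)]
    have : 0 ≤ ∫ u in s..t, auxz D S F (fun _ => 1) u := by
      refine intervalIntegral.integral_nonneg hst fun u hu => ?_
      have := auxz_bound D S hc F hFcpt hF (fun _ => 1) continuous_const 1 (by simp) u
        (hs'.trans_le hu.1)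
      have := (abs_nonneg _).trans this
      linarith
    linarith
  have hbdd : BddBelow ((fun ε => c - ∫ t in ε..1, auxz D S F (fun _ => 1) t) '' Ioi (0:ℝ)) := by
    refine ⟨0, ?_⟩
    rintro _ ⟨ε, hε, rfl⟩
    simp only
    rw [← key ε hε]; exact hJ0 ε hε
  have hlim := hmono.tendsto_nhdsGT hbdd
  refine aux_limit (fun i => r i ^ D) r hp hDsum ρ0 ρ1 h0 h1 hr0 hr1 H
    (fun s t hs hst => aux_H_anti D F hFcpt s t hs hst) _ (hlim.congr' ?_)
  filter_upwards [self_mem_nhdsWithin] with ε hε using (key ε hε).symm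

lemma aux_meas (D : ℝ) (hD : 0 < D) (r : Fin N → ℝ) (hr : ∀ i, r i ∈ Set.Ioo (0 : ℝ) 1)
    (hDsum : ∑ i, r i ^ D = 1)
    (S : Fin N → EE → EE) (hSsurj : ∀ i, Function.Surjective (S i))
    (hSdist : ∀ i x y, dist (S i x) (S i y) = r i * dist x y)
    (F : Set EE) (hF : F = ⋃ i, S i '' F)
    (hHfin : Measure.hausdorffMeasure (d := D) F < ⊤)
    (f : EE → ℝ) (hf : Continuous f) (M : ℝ) (hM : ∀ x, |f x| ≤ M) :
    ∫ x in F, f x ∂(Measure.hausdorffMeasure D) =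
      ∫ x in F, auxT (fun i => r i ^ D) S f x ∂(Measure.hausdorffMeasure D) := by
  have hc : ∀ i, Continuous (S i) := fun i => (aux_emb (S i) (r i) (hr i).1 (hSdist i)).1
  have himg : ∀ i, ∀ A : Set EE, Measure.hausdorffMeasure D (S i '' A) =
      ENNReal.ofReal (r i ^ D) * Measure.hausdorffMeasure D A := fun i A =>
    aux_hausdorff (S i) (r i) (hr i).1 (hSdist i) D hD.le A
  have hp : ∀ i, 0 < r i ^ D := fun i => Real.rpow_pos_of_pos (hr i).1 D
  have ho := aux_overlap (Measure.hausdorffMeasure D) (fun i => S i '' F) (fun i => by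
    rw [himg]; exact ENNReal.mul_ne_top ENNReal.ofReal_ne_top hHfin.ne) f hf.measurable M hM
  rw [← hF] at ho
  have h1 : ∑ i, (Measure.hausdorffMeasure D : Measure EE).real (S i '' F) =
      (Measure.hausdorffMeasure D : Measure EE).real F := by
    have : ∀ i, (Measure.hausdorffMeasure D : Measure EE).real (S i '' F) =
      r i ^ D * (Measure.hausdorffMeasure D : Measure EE).real F := fun i => by
      simp only [Measure.real]
      rw [himg, ENNReal.toReal_mul, ENNReal.toReal_ofReal (hp i).le]
    simp_rw [this]
    rw [← Finset.sum_mul, hDsum, one_mul]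
  rw [h1, sub_self, mul_zero] at ho
  have ho' := sub_eq_zero.1 (abs_nonpos_iff.1 ho)
  rw [← ho']
  unfold auxT
  have : IsFiniteMeasure ((Measure.hausdorffMeasure D : Measure EE).restrict F) :=
    ⟨by simpa using hHfin⟩
  rw [integral_finsetSum]
  · refine Finset.sum_congr rfl fun i _ => ?_
    rw [integral_const_mul]
    exact aux_image _ (S i) (aux_emb (S i) (r i) (hr i).1 (hSdist i)).2 (hSsurj i) _ (hp i)
      (himg i) F f
  · intro i _
    exact (Integrable.of_bound (hf.comp (hc i)).measurable.aestronglyMeasurable M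
      (ae_of_all _ fun x => hM _)).const_mul _

lemma aux_osc (p r : Fin N → ℝ) (hp : ∀ i, 0 ≤ p i) (hp1 : ∑ i, p i = 1)
    (ρ1 : ℝ) (h0 : 0 ≤ ρ1) (hr1 : ∀ i, r i ≤ ρ1)
    (S : Fin N → EE → EE) (hSdist : ∀ i x y, dist (S i x) (S i y) = r i * dist x y)
    (B : Set EE) (hB : ∀ i, ∀ x ∈ B, S i x ∈ B) (f : EE → ℝ) (δ η : ℝ)
    (hf : ∀ x ∈ B, ∀ y ∈ B, dist x y < δ → |f x - f y| ≤ η) (n : ℕ) :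
    ∀ x ∈ B, ∀ y ∈ B, ρ1 ^ n * dist x y < δ →
      |(auxT p S)^[n] f x - (auxT p S)^[n] f y| ≤ η := by
  induction n with
  | zero => simpa using hf
  | succ n ih =>
    intro x hx y hy h
    rw [Function.iterate_succ_apply']
    unfold auxT
    rw [← Finset.sum_sub_distrib]
    refine (Finset.abs_sum_le_sum_abs _ _).trans ?_
    calc _ ≤ ∑ i, p i * η := by
          refine Finset.sum_le_sum fun i _ => ?_
          rw [← mul_sub, abs_mul, abs_of_nonneg (hp i)]
          refine mul_le_mul_of_nonneg_left (ih _ (hB i x hx) _ (hB i y hy) ?_) (hp i)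
          rw [hSdist]
          refine lt_of_le_of_lt ?_ h
          calc ρ1 ^ n * (r i * dist x y) ≤ ρ1 ^ n * (ρ1 * dist x y) := by gcongr; exact hr1 i
            _ = _ := by ring
      _ = η := by rw [← Finset.sum_mul, hp1, one_mul]

end main

/-- (Case `k = d` of Theorem 3.2.) For a self-similar set `F` satisfying the open set
condition with `0 < H^D(F) < ∞`, the average Minkowski content `C_d^f(F)` exists and,
for every bounded continuous `f : ℝ^d → ℝ`, the averaged integrals
`|ln ε|⁻¹ ∫_ε^1 t^{D−d} (∫_{F_t} f dλ_d) dt/t` converge to `C_d^f(F) ∫ f dμ_F`,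
where `μ_F` is the normalized `D`-dimensional Hausdorff measure on `F`; i.e. the
rescaled volume measures of the parallel sets converge weakly to `C_d^f(F) μ_F`. -/
theorem stmt17 {d N : ℕ} (hN : 2 ≤ N)
    (r : Fin N → ℝ) (hr : ∀ i, r i ∈ Set.Ioo (0 : ℝ) 1)
    (S : Fin N → EuclideanSpace ℝ (Fin d) → EuclideanSpace ℝ (Fin d))
    (hSsurj : ∀ i, Function.Surjective (S i))
    (hSdist : ∀ i x y, dist (S i x) (S i y) = r i * dist x y)
    (F : Set (EuclideanSpace ℝ (Fin d))) (hFne : F.Nonempty) (hFcpt : IsCompact F)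
    (hF : F = ⋃ i, S i '' F)
    (hOSC : ∃ O : Set (EuclideanSpace ℝ (Fin d)), O.Nonempty ∧ IsOpen O ∧
      Bornology.IsBounded O ∧ (⋃ i, S i '' O) ⊆ O ∧
      ∀ i j, i ≠ j → S i '' O ∩ S j '' O = ∅)
    (D : ℝ) (hD : 0 < D) (hDsum : ∑ i, r i ^ D = 1)
    (hHpos : 0 < Measure.hausdorffMeasure (d := D) F)
    (hHfin : Measure.hausdorffMeasure (d := D) F < ⊤)
    (μF : Measure (EuclideanSpace ℝ (Fin d)))
    (hμF : μF = (Measure.hausdorffMeasure (d := D) F)⁻¹ •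
      (Measure.hausdorffMeasure (d := D)).restrict F) :
    ∃ Cf : ℝ,
      Filter.Tendsto (fun δ : ℝ => |Real.log δ|⁻¹ *
          ∫ t in Set.Ioc δ 1, t ^ (D - d) * (volume (cthickening t F)).toReal * t⁻¹)
        (nhdsWithin 0 (Set.Ioi 0)) (nhds Cf) ∧
      ∀ f : EuclideanSpace ℝ (Fin d) → ℝ, Continuous f → (∃ M : ℝ, ∀ x, |f x| ≤ M) →
        Filter.Tendsto (fun ε : ℝ => |Real.log ε|⁻¹ *
            ∫ t in Set.Ioc ε 1, t ^ (D - d) * (∫ x in cthickening t F, f x) * t⁻¹)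
          (nhdsWithin 0 (Set.Ioi 0)) (nhds (Cf * ∫ x, f x ∂μF)) := by
  have hc : ∀ i, Continuous (S i) := fun i => (aux_emb (S i) (r i) (hr i).1 (hSdist i)).1
  have hp : ∀ i, 0 ≤ r i ^ D := fun i => Real.rpow_nonneg (hr i).1.le D
  have hne : (Finset.univ : Finset (Fin N)).Nonempty := ⟨⟨0, by omega⟩, Finset.mem_univ _⟩
  obtain ⟨i0, -, hi0⟩ := Finset.exists_min_image Finset.univ r hne
  obtain ⟨i1, -, hi1⟩ := Finset.exists_max_image Finset.univ r hne
  have hr0 : ∀ i, r i0 ≤ r i := fun i => hi0 i (Finset.mem_univ _)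
  have hr1 : ∀ i, r i ≤ r i1 := fun i => hi1 i (Finset.mem_univ _)
  obtain ⟨Cf, hCf⟩ := aux_content D r hr hDsum S hSsurj hSdist F hFcpt hF (r i0) (r i1)
    (hr i0).1 (hr i1).2 hr0 hr1
  have hev1 : ∀ᶠ t in nhdsWithin (0:ℝ) (Ioi 0), t ∈ Ioo (0:ℝ) 1 := Ioo_mem_nhdsGT one_pos
  refine ⟨Cf, ?_, ?_⟩
  · refine hCf.congr' ?_
    filter_upwards [hev1] with ε hε
    rw [intervalIntegral.integral_of_le hε.2.le]
    congr 1
    refine integral_congr_ae (ae_of_all _ fun t => ?_)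
    simp [auxh, auxP, Measure.real]
  intro f hf ⟨M, hM⟩
  set T := auxT (fun i => r i ^ D) S with hTdef
  have hTc : ∀ n, Continuous (T^[n] f) := by
    intro n
    induction n with
    | zero => simpa using hf
    | succ n ih =>
      rw [Function.iterate_succ_apply']
      simp only [hTdef]
      unfold auxT
      exact continuous_finsetSum _ fun i _ => continuous_const.mul (ih.comp (hc i))
  have hTM : ∀ n x, |T^[n] f x| ≤ M := by
    intro n
    induction n with
    | zero => simpa using hM
    | succ n ih =>
      rw [Function.iterate_succ_apply']
      exact auxT_bound _ hp hDsum S _ M ih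
  obtain ⟨C, hC⟩ := aux_step D r hr hDsum S hSsurj hSdist F hFcpt hF
  have hCn : ∀ n : ℕ, ∀ ε ∈ Ioc (0:ℝ) 1, |(∫ t in ε..1, auxh D F f t) -
      ∫ t in ε..1, auxh D F (T^[n] f) t| ≤ n * (C * M) := by
    intro n ε hε
    induction n with
    | zero => simp
    | succ n ih =>
      have := hC (T^[n] f) (hTc n) M (hTM n) ε hε
      rw [← hTdef, ← Function.iterate_succ_apply' T n f] at this
      have h3 := abs_sub_le (∫ t in ε..1, auxh D F f t) (∫ t in ε..1, auxh D F (T^[n] f) t)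
        (∫ t in ε..1, auxh D F (T^[n+1] f) t)
      push_cast
      linarith
  -- the measure
  set m : Measure (EuclideanSpace ℝ (Fin d)) := Measure.hausdorffMeasure D with hmdef
  have hprob : IsProbabilityMeasure μF := ⟨by
    rw [hμF, Measure.smul_apply, Measure.restrict_apply_univ, smul_eq_mul]
    exact ENNReal.inv_mul_cancel hHpos.ne' hHfin.ne⟩
  have hμT : ∀ n, ∫ x, f x ∂μF = ∫ x, T^[n] f x ∂μF := by
    intro n
    induction n with
    | zero => simp
    | succ n ih =>
      rw [ih, Function.iterate_succ_apply', hμF, integral_smul_measure, integral_smul_measure]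
      congr 1
      exact aux_meas D hD r hr hDsum S hSsurj hSdist F hF hHfin _ (hTc n) M (hTM n)
  have haeF : ∀ᵐ x ∂μF, x ∈ F := by
    rw [hμF]
    exact Measure.ae_smul_measure (ae_restrict_mem hFcpt.measurableSet) _
  -- the compact set
  have hBc : IsCompact (cthickening 1 F) := hFcpt.cthickening
  have hFB : F ⊆ cthickening 1 F := self_subset_cthickening F
  have hB : ∀ i, ∀ x ∈ cthickening 1 F, S i x ∈ cthickening 1 F := by
    intro i x hx
    rw [hFcpt.cthickening_eq_biUnion_closedBall zero_le_one] at hx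
    simp only [mem_iUnion, mem_closedBall, exists_prop] at hx
    obtain ⟨z, hz, hd⟩ := hx
    refine mem_cthickening_of_dist_le (S i x) (S i z) 1 F ?_ ?_
    · rw [hF]; exact mem_iUnion.2 ⟨i, mem_image_of_mem _ hz⟩
    · rw [hSdist]
      have := (hr i).2
      have := (hr i).1
      nlinarith [dist_nonneg (x := x) (y := z)]
  obtain ⟨x0, hx0⟩ := hFne
  have huc := hBc.uniformContinuousOn_of_continuous hf.continuousOn
  rw [Metric.uniformContinuousOn_iff] at huc
  obtain ⟨R, hR⟩ := hBc.isBounded.subset_closedBall x0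
  have hCf0 : 0 ≤ Cf := by
    refine ge_of_tendsto hCf ?_
    filter_upwards [hev1] with ε hε
    refine mul_nonneg (by positivity) ?_
    exact intervalIntegral.integral_nonneg hε.2.le fun u hu => auxh_nonneg D F u (hε.1.trans_le hu.1)
  have hlog : Tendsto (fun t : ℝ => |Real.log t|⁻¹) (nhdsWithin 0 (Ioi 0)) (nhds 0) :=
    tendsto_inv_atTop_zero.comp (tendsto_abs_atBot_atTop.comp Real.tendsto_log_nhdsGT_zero)
  -- reduction to interval integrals
  suffices hmain : Tendsto (fun ε => |Real.log ε|⁻¹ * ∫ t in ε..1, auxh D F f t)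
      (nhdsWithin 0 (Ioi 0)) (nhds (Cf * ∫ x, f x ∂μF)) by
    refine hmain.congr' ?_
    filter_upwards [hev1] with ε hε
    rw [intervalIntegral.integral_of_le hε.2.le]
    rfl
  have hM0 : 0 ≤ M := (abs_nonneg _).trans (hM 0)
  rw [Metric.tendsto_nhds]
  intro κ hκ
  set η := κ / (4 * (Cf + 1)) with hηdef
  have hη : 0 < η := by positivity
  obtain ⟨δ, hδ, hδf⟩ := huc η hη
  have hR0 : 0 ≤ R := by simpa using hR (hFB hx0)
  obtain ⟨n, hn⟩ := exists_pow_lt_of_lt_one (show 0 < δ / (R + 1) by positivity) (hr i1).2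
  have hn' : r i1 ^ n * (R + 1) < δ := by rwa [lt_div_iff₀ (by positivity)] at hn
  have hosc := aux_osc (fun i => r i ^ D) r hp hDsum (r i1) (hr i1).1.le hr1 S hSdist
    (cthickening 1 F) hB f δ η (fun x hx y hy h => by
      have := hδf x hx y hy h; rw [Real.dist_eq] at this; exact this.le) n
  rw [← hTdef] at hosc
  set g := T^[n] f with hg
  set c := g x0 with hcdef
  have hgc : ∀ x ∈ cthickening 1 F, |g x - c| ≤ η := by
    intro x hx
    refine hosc x hx x0 (hFB hx0) ?_
    have h1 : dist x x0 ≤ R := hR hx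
    refine lt_of_le_of_lt ?_ hn'
    have := pow_nonneg (hr i1).1.le n
    gcongr
    linarith
  have hc_abs : |c| ≤ M := hTM n x0
  have hgint : |∫ x, f x ∂μF - c| ≤ η := by
    rw [hμT n]
    have hi : Integrable g μF := Integrable.of_bound (hTc n).measurable.aestronglyMeasurable M
      (ae_of_all _ fun x => hTM n x)
    have e : ∫ x, g x ∂μF - c = ∫ x, (g x - c) ∂μF := by
      rw [integral_sub hi (integrable_const c)]; simp
    rw [← hg, e]
    have := norm_integral_le_of_norm_le_const (μ := μF) (f := fun x => g x - c) (C := η)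
      (haeF.mono fun x hx => hgc x (hFB hx))
    simpa using this
  have t1 : Tendsto (fun ε : ℝ => |Real.log ε|⁻¹ * (n * (C * M))) (nhdsWithin 0 (Ioi 0)) (nhds 0) := by
    simpa using hlog.mul_const ((n : ℝ) * (C * M))
  have t2 := t1.eventually (eventually_lt_nhds (show (0:ℝ) < κ / 4 by positivity))
  have t3 := (Metric.tendsto_nhds.1 hCf) (min 1 (κ / (4 * (M + 1)))) (by positivity)
  filter_upwards [hev1, t2, t3] with ε hε t2 t3
  set lam := |Real.log ε|⁻¹ with hlam
  have hl0 : 0 ≤ lam := by positivity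
  set H1 := ∫ t in ε..1, auxh D F (fun _ => 1) t with hH1
  set Hf := ∫ t in ε..1, auxh D F f t with hHf
  set Hg := ∫ t in ε..1, auxh D F g t with hHg
  have s1 : |lam * Hf - lam * Hg| < κ / 4 := by
    rw [← mul_sub, abs_mul, abs_of_nonneg hl0]
    exact lt_of_le_of_lt (mul_le_mul_of_nonneg_left (hCn n ε ⟨hε.1, hε.2.le⟩) hl0) t2
  have s2 : |Hg - c * H1| ≤ η * H1 := by
    have i1 : IntervalIntegrable (auxh D F (fun _ => 1)) volume ε 1 :=
      auxh_int D F hFcpt _ continuous_const 1 (by simp) ε 1 hε.1 one_pos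
    have i2 : IntervalIntegrable (auxh D F g) volume ε 1 :=
      auxh_int D F hFcpt _ (hTc n) M (hTM n) ε 1 hε.1 one_pos
    rw [hHg, hH1, ← intervalIntegral.integral_const_mul, ← intervalIntegral.integral_const_mul,
      ← intervalIntegral.integral_sub i2 (i1.const_mul c), ← Real.norm_eq_abs]
    refine intervalIntegral.norm_integral_le_of_norm_le hε.2.le (ae_of_all _ fun u hu => ?_)
      (i1.const_mul η)
    exact auxh_bound D F hFcpt g (hTc n) u η (hε.1.trans hu.1) c
      (fun x hx => hgc x (cthickening_mono hu.2 F hx))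
  rw [Real.dist_eq] at t3 ⊢
  have t4 : lam * H1 ≤ Cf + 1 := by
    have := (le_abs_self _).trans (t3.le.trans (min_le_left _ _)); linarith
  have t5 : |lam * H1 - Cf| < κ / (4 * (M + 1)) := t3.trans_le (min_le_right _ _)
  have s2' : |lam * Hg - c * (lam * H1)| ≤ κ / 4 := by
    have e : lam * Hg - c * (lam * H1) = lam * (Hg - c * H1) := by ring
    rw [e, abs_mul, abs_of_nonneg hl0]
    calc lam * |Hg - c * H1| ≤ lam * (η * H1) := by gcongr
      _ = η * (lam * H1) := by ring
      _ ≤ η * (Cf + 1) := by gcongr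
      _ = κ / 4 := by rw [hηdef]; field_simp
  have s3 : |c * (lam * H1) - c * Cf| ≤ κ / 4 := by
    rw [← mul_sub, abs_mul]
    calc |c| * |lam * H1 - Cf| ≤ (M + 1) * (κ / (4 * (M + 1))) := by
          gcongr; linarith
      _ = κ / 4 := by field_simp
  have s4 : |c * Cf - Cf * ∫ x, f x ∂μF| ≤ κ / 4 := by
    rw [mul_comm c, ← mul_sub, abs_mul, abs_of_nonneg hCf0, abs_sub_comm]
    calc Cf * |∫ x, f x ∂μF - c| ≤ (Cf + 1) * η := by
          gcongr; linarith
      _ = κ / 4 := by rw [hηdef]; field_simp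
  rw [abs_lt] at s1 ⊢
  rw [abs_le] at s2' s3 s4
  constructor <;> linarith [s1.1, s1.2, s2'.1, s2'.2, s3.1, s3.2, s4.1, s4.2]
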